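/- The functions x ↦ log Φ(x) and x ↦ log(1 - Φ(x)) are concave on ℝ, where Φ is the standard normal cumulative distribution function. Consequently, for every fixed y ∈ [0,1], the probit log-likelihood x ↦ y log Φ(x) + (1 - y) log(1 - Φ(x)) is a concave function on ℝ. -/

import Mathlib

open MeasureTheory Real

/-- The standard normal probability density function. -/
noncomputable def stdPdf (x : ℝ) : ℝ := (Real.sqrt (2 * Real.pi))⁻¹ * Real.exp (-(x ^ 2) / 2)

/-- The standard normal cumulative distribution function. -/
noncomputable def stdCdf (x : ℝ) : ℝ := ∫ t in Set.Iic x, stdPdf t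

lemma stdPdf_eq_mul_exp (x : ℝ) :
    stdPdf x = (Real.sqrt (2 * Real.pi))⁻¹ * Real.exp (-(1 / 2) * x ^ 2) := by
  unfold stdPdf
  congr 2
  ring

lemma stdPdf_pos (x : ℝ) : 0 < stdPdf x := by
  unfold stdPdf
  positivity

lemma stdPdf_neg (x : ℝ) : stdPdf (-x) = stdPdf x := by
  simp [stdPdf]

lemma continuous_stdPdf : Continuous stdPdf := by
  unfold stdPdf
  fun_prop

lemma integrable_stdPdf : Integrable stdPdf := by
  rw [funext stdPdf_eq_mul_exp]
  exact (integrable_exp_neg_mul_sq (by norm_num)).const_mul _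

lemma integrable_id_mul_stdPdf : Integrable (fun t => t * stdPdf t) := by
  refine ((integrable_mul_exp_neg_mul_sq (b := 1 / 2) (by norm_num)).const_mul
    (Real.sqrt (2 * Real.pi))⁻¹).congr (.of_forall fun t => ?_)
  simp only [stdPdf_eq_mul_exp]
  ring

lemma integral_stdPdf : ∫ t, stdPdf t = 1 := by
  simp_rw [stdPdf_eq_mul_exp]
  rw [integral_const_mul, integral_gaussian, show π / (1 / 2) = 2 * π by ring]
  exact inv_mul_cancel₀ (by positivity)

lemma hasDerivAt_stdPdf (x : ℝ) : HasDerivAt stdPdf (-(x * stdPdf x)) x := by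
  have h : HasDerivAt (fun t : ℝ => -(t ^ 2) / 2) (-x) x := by
    refine ((hasDerivAt_pow 2 x).neg.div_const 2).congr_deriv ?_
    norm_num
    ring
  refine (h.exp.const_mul (Real.sqrt (2 * Real.pi))⁻¹).congr_deriv ?_
  unfold stdPdf
  ring

lemma tendsto_stdPdf_atBot : Filter.Tendsto stdPdf Filter.atBot (nhds 0) := by
  refine tendsto_zero_of_hasDerivAt_of_integrableOn_Iic (a := 0)
    (fun x _ => hasDerivAt_stdPdf x) ?_ integrable_stdPdf.integrableOn
  exact integrable_id_mul_stdPdf.neg.integrableOn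

lemma stdCdf_pos (x : ℝ) : 0 < stdCdf x := by
  unfold stdCdf
  rw [setIntegral_pos_iff_support_of_nonneg_ae (.of_forall fun t => (stdPdf_pos t).le)
    integrable_stdPdf.integrableOn]
  have h : Function.support stdPdf = Set.univ :=
    Set.eq_univ_of_forall fun t => (stdPdf_pos t).ne'
  simp [h]

lemma hasDerivAt_stdCdf (x : ℝ) : HasDerivAt stdCdf (stdPdf x) x := by
  have h : stdCdf = fun u => (∫ t in (0 : ℝ)..u, stdPdf t) + stdCdf 0 := by
    funext u
    rw [← intervalIntegral.integral_Iic_sub_Iic integrable_stdPdf.integrableOn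
      integrable_stdPdf.integrableOn]
    simp [stdCdf]
  rw [h]
  exact (continuous_stdPdf.integral_hasStrictDerivAt 0 x).hasDerivAt.add_const _

lemma one_sub_stdCdf (x : ℝ) : 1 - stdCdf x = stdCdf (-x) := by
  have h : stdCdf (-x) = ∫ t in Set.Ioi x, stdPdf t := by
    have h := integral_comp_neg_Iic (-x) stdPdf
    simp_rw [stdPdf_neg, neg_neg] at h
    exact h
  rw [h, ← integral_stdPdf, stdCdf,
    ← intervalIntegral.integral_Iic_add_Ioi integrable_stdPdf.integrableOn
      integrable_stdPdf.integrableOn]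
  ring

lemma neg_id_mul_stdCdf_le_stdPdf (x : ℝ) : -(x * stdCdf x) ≤ stdPdf x := by
  have h : ∫ t in Set.Iic x, -(t * stdPdf t) = stdPdf x := by
    simpa using integral_Iic_of_hasDerivAt_of_tendsto' (fun t _ => hasDerivAt_stdPdf t)
      integrable_id_mul_stdPdf.neg.integrableOn tendsto_stdPdf_atBot
  rw [← h, stdCdf, ← integral_const_mul, ← integral_neg]
  refine setIntegral_mono_on (integrable_stdPdf.const_mul x).neg.integrableOn
    integrable_id_mul_stdPdf.neg.integrableOn measurableSet_Iic fun t ht => ?_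
  exact neg_le_neg (mul_le_mul_of_nonneg_right ht (stdPdf_pos t).le)

lemma concaveOn_log_stdCdf : ConcaveOn ℝ Set.univ (fun x => Real.log (stdCdf x)) := by
  have hlog (x : ℝ) : HasDerivAt (fun x => Real.log (stdCdf x)) (stdPdf x / stdCdf x) x :=
    (hasDerivAt_stdCdf x).log (stdCdf_pos x).ne'
  have hratio (x : ℝ) := (hasDerivAt_stdPdf x).div (hasDerivAt_stdCdf x) (stdCdf_pos x).ne'
  refine Antitone.concaveOn_univ_of_deriv (fun x => (hlog x).differentiableAt) ?_
  rw [funext fun x => (hlog x).deriv]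
  refine antitone_of_deriv_nonpos (fun x => (hratio x).differentiableAt) fun x => ?_
  refine (hratio x).deriv.trans_le (div_nonpos_of_nonpos_of_nonneg ?_ (sq_nonneg _))
  nlinarith [mul_le_mul_of_nonneg_left (neg_id_mul_stdCdf_le_stdPdf x) (stdPdf_pos x).le]

/-- `x ↦ log Φ(x)` and `x ↦ log(1 - Φ(x))` are concave on `ℝ`; consequently, for every
`y ∈ [0,1]`, the probit log-likelihood `x ↦ y log Φ(x) + (1-y) log(1 - Φ(x))` is concave. -/
theorem probit_loglik_concave :
    ConcaveOn ℝ Set.univ (fun x => Real.log (stdCdf x)) ∧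
      ConcaveOn ℝ Set.univ (fun x => Real.log (1 - stdCdf x)) ∧
      ∀ y ∈ Set.Icc (0 : ℝ) 1,
        ConcaveOn ℝ Set.univ
          (fun x => y * Real.log (stdCdf x) + (1 - y) * Real.log (1 - stdCdf x)) := by
  have h : ConcaveOn ℝ Set.univ (fun x => Real.log (1 - stdCdf x)) := by
    simp_rw [one_sub_stdCdf]
    exact concaveOn_log_stdCdf.comp_linearMap (-LinearMap.id)
  exact ⟨concaveOn_log_stdCdf, h, fun y hy =>
    (concaveOn_log_stdCdf.smul hy.1).add (h.smul (sub_nonneg.2 hy.2))⟩
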